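/- The set G_aff := ⋃_{w ∈ W_aff} IwI is a subgroup of G; the set H^aff of elements of H(G,I) vanishing outside G_aff is a subring with ℤ-basis {i_w : w ∈ W_aff}; and the ℤ-linear map ℤ[Ω] ⊗_ℤ H^aff → H(G,I) sending u ⊗ f to i_u ⋆ f is bijective and transports the multiplication of H(G,I) to the twisted product determined by (u ⊗ i_w)·(u' ⊗ i_{w'}) = uu' ⊗ (i_{u'⁻¹wu'} ⋆ i_{w'}) for u, u' ∈ Ω and w, w' ∈ W_aff. -/

import Mathlib

open scoped Pointwise

/-! ## Setting

`G` is a group with subgroups `I` and `N` such that `T := I ⊓ N` is normal in `N`, and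
`W̃ := N/T` is presented via a surjective homomorphism `π : N →* W̃` whose kernel consists of
the elements of `N` lying in `I`.  `W̃ = W_aff ⋊ Ω` is an internal semidirect product, where
`W_aff` carries a Coxeter system `cs` (with simple reflections indexed by `B`), the length
function `ℓ` of `cs` is extended to `W̃` by `ℓ (w * u) = ℓ w` for `w ∈ W_aff`, `u ∈ Ω`, and
the axioms (T0), (T3), (T4), (TΩ), (TS), (TF) hold. -/

/-- The double coset `I·n·I ⊆ G` attached to an element `w ∈ W̃ = N/T`, described as the union
of `I·n·I` over all representatives `n ∈ N` of `w` (these double cosets all coincide, since any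
two representatives differ by an element of `T = I ⊓ N ⊆ I`). -/
def IwI {G : Type} [Group G] {W : Type} [Group W] (I : Subgroup G) {N : Subgroup G}
    (π : N →* W) (w : W) : Set G :=
  {g : G | ∃ n : N, π n = w ∧ ∃ i ∈ I, ∃ j ∈ I, g = i * (n : G) * j}

/-- The basis element `i_w = 1_{IwI} : G → ℤ` of the Iwahori–Hecke ring. -/
noncomputable def iw {G : Type} [Group G] {W : Type} [Group W] (I : Subgroup G) {N : Subgroup G}
    (π : N →* W) (w : W) : G → ℤ :=
  (IwI I π w).indicator fun _ => (1 : ℤ)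

/-- Convolution of `ℤ`-valued functions on `G` relative to `I`:
`(f ⋆ f')(x) = Σ_{yI ∈ G/I} f(y)·f'(y⁻¹x)` (the value of `f` at a left coset `yI` is computed
at a chosen representative; this is independent of the choices when `f` is right `I`-invariant
and `f'` is left `I`-invariant). -/
noncomputable def hconv {G : Type} [Group G] (I : Subgroup G) (f f' : G → ℤ) : G → ℤ :=
  fun x => ∑ᶠ y : G ⧸ I, f (Quotient.out y) * f' ((Quotient.out y)⁻¹ * x)

/-- The left cosets of `I` contained in a (right `I`-stable) subset `A ⊆ G`, viewed as the
image of `A` in `G/I`. -/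
def leftCosetsIn {G : Type} [Group G] (I : Subgroup G) (A : Set G) : Set (G ⧸ I) :=
  QuotientGroup.mk '' A

/-- A function `f : G → ℤ` belongs to the Iwahori–Hecke ring `H(G,I)` iff it is left and right
`I`-invariant and vanishes outside finitely many double cosets of `I`. -/
def IsHeckeElt {G : Type} [Group G] {W : Type} [Group W] (I : Subgroup G) {N : Subgroup G}
    (π : N →* W) (f : G → ℤ) : Prop :=
  (∀ i ∈ I, ∀ g : G, f (i * g) = f g) ∧ (∀ i ∈ I, ∀ g : G, f (g * i) = f g) ∧
    {w : W | ∃ g ∈ IwI I π w, f g ≠ 0}.Finite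

/-- The data and axioms of the Iwahori–Matsumoto setting. -/
structure IwahoriHeckeSetup (G W B : Type) [Group G] [Group W] (M : CoxeterMatrix B) where
  /-- the "Iwahori" subgroup -/
  I : Subgroup G
  /-- the subgroup `N` -/
  N : Subgroup G
  /-- the quotient map `N → W̃ = N/T`, `T = I ∩ N` -/
  π : N →* W
  π_surjective : Function.Surjective π
  /-- the kernel of `π` is exactly `T = I ∩ N` (so `T` is normal in `N` and `W̃ = N/T`) -/
  π_ker : ∀ n : N, π n = 1 ↔ (n : G) ∈ I
  /-- the normal subgroup `W_aff` of `W̃` -/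
  Waff : Subgroup W
  /-- the subgroup `Ω` of `W̃` -/
  Om : Subgroup W
  Waff_normal : Waff.Normal
  /-- `W̃ = W_aff · Ω` -/
  sd_prod : ∀ w : W, ∃ wa ∈ Waff, ∃ u ∈ Om, w = wa * u
  /-- `W_aff ∩ Ω = 1` -/
  sd_disj : Waff ⊓ Om = ⊥
  /-- the Coxeter system `(W_aff, S)`, `S = {simple b | b : B}` -/
  cs : CoxeterSystem M Waff
  /-- the length function of `(W_aff, S)`, extended to `W̃` -/
  len : W → ℕ
  len_spec : ∀ (wa : Waff) (u : Om), len ((wa : W) * (u : W)) = cs.length wa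
  /-- `q w` = the number of left cosets of `I` contained in `IwI` -/
  q : W → ℕ
  /-- (T0): `G` is covered by the double cosets `IwI`, `w ∈ W̃` ... -/
  T0_cover : ∀ g : G, ∃ w : W, g ∈ IwI I π w
  /-- (T0): ... and distinct double cosets are disjoint -/
  T0_disjoint : ∀ w w' : W, w ≠ w' → Disjoint (IwI I π w) (IwI I π w')
  /-- (T3): `sIw ⊆ IwI ∪ IswI` for all `s ∈ S`, `w ∈ W̃` -/
  T3 : ∀ (b : B) (w : W) (ns nw : N), π ns = (cs.simple b : W) → π nw = w →
      ∀ i ∈ I, (ns : G) * i * (nw : G) ∈ IwI I π w ∪ IwI I π ((cs.simple b : W) * w)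
  /-- (T4): `sIs ⊄ I` for all `s ∈ S` -/
  T4 : ∀ (b : B) (ns ns' : N), π ns = (cs.simple b : W) → π ns' = (cs.simple b : W) →
      ¬ (∀ i ∈ I, (ns : G) * i * (ns' : G) ∈ I)
  /-- (TΩ): representatives in `N` of elements of `Ω` normalize `I` -/
  TOm : ∀ n : N, π n ∈ Om → ∀ i ∈ I, (n : G) * i * (n : G)⁻¹ ∈ I
  /-- (TS): `uSu⁻¹ = S` for all `u ∈ Ω` -/
  TS : ∀ u ∈ Om, ∀ b : B, ∃ b' : B, u * (cs.simple b : W) * u⁻¹ = (cs.simple b' : W)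
  /-- (TF): every double coset `IwI` is a finite union of left cosets of `I`, and `q w` is
  their number -/
  TF : ∀ w : W, (leftCosetsIn I (IwI I π w)).Finite ∧
      q w = (leftCosetsIn I (IwI I π w)).ncard

/-- The set `G_aff := ⋃_{w ∈ W_aff} IwI ⊆ G`. -/
def Gaff {G W B : Type} [Group G] [Group W] {M : CoxeterMatrix B}
    (D : IwahoriHeckeSetup G W B M) : Set G :=
  ⋃ w ∈ (D.Waff : Set W), IwI D.I D.π w

/-- Membership in `H^aff`: an element of `H(G,I)` vanishing outside `G_aff`. -/
def InHaff {G W B : Type} [Group G] [Group W] {M : CoxeterMatrix B}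
    (D : IwahoriHeckeSetup G W B M) (f : G → ℤ) : Prop :=
  IsHeckeElt D.I D.π f ∧ ∀ g ∉ Gaff D, f g = 0

section Helpers

variable {G W B : Type} [Group G] [Group W] {M : CoxeterMatrix B}

theorem IwI_left {I N : Subgroup G} {π : N →* W} {w : W} {i g : G} (hi : i ∈ I) :
    i * g ∈ IwI I π w ↔ g ∈ IwI I π w := by
  constructor
  · rintro ⟨n, hn, a, ha, b, hb, h⟩
    refine ⟨n, hn, i⁻¹ * a, I.mul_mem (I.inv_mem hi) ha, b, hb, ?_⟩
    have : g = i⁻¹ * (i * g) := by group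
    rw [this, h]; group
  · rintro ⟨n, hn, a, ha, b, hb, h⟩
    exact ⟨n, hn, i * a, I.mul_mem hi ha, b, hb, by rw [h]; group⟩

theorem IwI_right {I N : Subgroup G} {π : N →* W} {w : W} {i g : G} (hi : i ∈ I) :
    g * i ∈ IwI I π w ↔ g ∈ IwI I π w := by
  constructor
  · rintro ⟨n, hn, a, ha, b, hb, h⟩
    refine ⟨n, hn, a, ha, b * i⁻¹, I.mul_mem hb (I.inv_mem hi), ?_⟩
    have : g = (g * i) * i⁻¹ := by group
    rw [this, h]; group
  · rintro ⟨n, hn, a, ha, b, hb, h⟩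
    exact ⟨n, hn, a, ha, b * i, I.mul_mem hb hi, by rw [h]; group⟩

theorem IwI_self {I N : Subgroup G} {π : N →* W} (n : N) : (n : G) ∈ IwI I π (π n) :=
  ⟨n, rfl, 1, I.one_mem, 1, I.one_mem, by group⟩

theorem IwI_inv {I N : Subgroup G} {π : N →* W} {w : W} {g : G} (h : g ∈ IwI I π w) :
    g⁻¹ ∈ IwI I π w⁻¹ := by
  obtain ⟨n, hn, a, ha, b, hb, h⟩ := h
  exact ⟨n⁻¹, by simp [hn], b⁻¹, I.inv_mem hb, a⁻¹, I.inv_mem ha, by rw [h]; simp; group⟩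

theorem IwI_unique (D : IwahoriHeckeSetup G W B M) {w w' : W} {g : G}
    (h : g ∈ IwI D.I D.π w) (h' : g ∈ IwI D.I D.π w') : w = w' := by
  by_contra hne
  exact Set.disjoint_left.mp (D.T0_disjoint w w' hne) h h'

theorem TOm_iff (D : IwahoriHeckeSetup G W B M) {n : D.N} (hn : D.π n ∈ D.Om) (i : G) :
    (n : G) * i * (n : G)⁻¹ ∈ D.I ↔ i ∈ D.I := by
  refine ⟨fun h => ?_, fun h => D.TOm n hn i h⟩
  have := D.TOm n⁻¹ (by simpa using hn) _ h
  convert this using 1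
  simp; group

theorem Om_left' (D : IwahoriHeckeSetup G W B M) {n : D.N} (hn : D.π n ∈ D.Om) {w : W} {g : G}
    (h : g ∈ IwI D.I D.π w) : (n : G) * g ∈ IwI D.I D.π (D.π n * w) := by
  obtain ⟨m, hm, a, ha, b, hb, h⟩ := h
  exact ⟨n * m, by simp [hm], (n : G) * a * (n : G)⁻¹, D.TOm n hn a ha, b, hb,
    by rw [h]; simp; group⟩

theorem Om_left (D : IwahoriHeckeSetup G W B M) {n : D.N} (hn : D.π n ∈ D.Om) {w : W} {g : G} :
    (n : G) * g ∈ IwI D.I D.π (D.π n * w) ↔ g ∈ IwI D.I D.π w := by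
  refine ⟨fun h => ?_, Om_left' D hn⟩
  have := Om_left' D (n := n⁻¹) (by simpa using hn) h
  simpa using this

theorem Om_right' (D : IwahoriHeckeSetup G W B M) {n : D.N} (hn : D.π n ∈ D.Om) {w : W} {g : G}
    (h : g ∈ IwI D.I D.π w) : g * (n : G) ∈ IwI D.I D.π (w * D.π n) := by
  have := IwI_inv (Om_left' D (n := n⁻¹) (by simpa using hn) (IwI_inv h))
  simpa using this

theorem Om_conj' (D : IwahoriHeckeSetup G W B M) {n : D.N} (hn : D.π n ∈ D.Om) {w : W} {g : G}
    (h : g ∈ IwI D.I D.π w) :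
    (n : G) * g * (n : G)⁻¹ ∈ IwI D.I D.π (D.π n * w * (D.π n)⁻¹) := by
  have := Om_right' D (n := n⁻¹) (by simpa using hn) (Om_left' D hn h)
  simpa using this

theorem Om_conj (D : IwahoriHeckeSetup G W B M) {n : D.N} (hn : D.π n ∈ D.Om) {w : W} {g : G} :
    (n : G) * g * (n : G)⁻¹ ∈ IwI D.I D.π w ↔
      g ∈ IwI D.I D.π ((D.π n)⁻¹ * w * D.π n) := by
  constructor
  · intro h
    have := Om_conj' D (n := n⁻¹) (by simpa using hn) h
    simpa [mul_assoc] using this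
  · intro h
    have := Om_conj' D hn h
    simpa [mul_assoc] using this

theorem mem_Gaff (D : IwahoriHeckeSetup G W B M) {g : G} :
    g ∈ Gaff D ↔ ∃ w ∈ D.Waff, g ∈ IwI D.I D.π w := by
  simp [Gaff]

theorem Gaff_of_word (D : IwahoriHeckeSetup G W B M) (w : D.Waff) :
    ∀ n : D.N, D.π n = w → ∀ g ∈ Gaff D, (n : G) * g ∈ Gaff D := by
  induction w using D.cs.simple_induction_left with
  | one =>
    intro n hn g hg
    have hI : (n : G) ∈ D.I := (D.π_ker n).1 (by simpa using hn)
    rw [mem_Gaff] at hg ⊢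
    obtain ⟨v, hv, hg⟩ := hg
    exact ⟨v, hv, (IwI_left hI).2 hg⟩
  | mul_simple_left w b ih =>
    intro n hn g hg
    obtain ⟨ns, hns⟩ := D.π_surjective (D.cs.simple b : W)
    have h1 : D.π (ns⁻¹ * n) = w := by simp [hns, hn]
    have h2 := ih _ h1 g hg
    rw [mem_Gaff] at h2 ⊢
    obtain ⟨v, hv, m, hm, i, hi, j, hj, h⟩ := h2
    have h3 := D.T3 b v ns m hns hm i hi
    have h4 : (n : G) * g = (ns : G) * i * m * j := by
      have : (n : G) * g = ns * (((ns⁻¹ * n : D.N) : G) * g) := by simp; group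
      rw [this, h]; group
    rcases h3 with h3 | h3
    · exact ⟨v, hv, by rw [h4]; exact (IwI_right hj).2 h3⟩
    · exact ⟨_, D.Waff.mul_mem (D.cs.simple b).2 hv, by rw [h4]; exact (IwI_right hj).2 h3⟩

theorem Gaff_mul (D : IwahoriHeckeSetup G W B M) {g h : G} (hg : g ∈ Gaff D) (hh : h ∈ Gaff D) :
    g * h ∈ Gaff D := by
  rw [mem_Gaff] at hg
  obtain ⟨v, hv, m, hm, i, hi, j, hj, rfl⟩ := hg
  have h1 : j * h ∈ Gaff D := by
    rw [mem_Gaff] at hh ⊢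
    obtain ⟨w, hw, h⟩ := hh
    exact ⟨w, hw, (IwI_left hj).2 h⟩
  have h2 := Gaff_of_word D ⟨v, hv⟩ m hm _ h1
  rw [mem_Gaff] at h2 ⊢
  obtain ⟨w, hw, h⟩ := h2
  refine ⟨w, hw, ?_⟩
  have := (IwI_left hi).2 h
  convert this using 1; group

theorem Gaff_one (D : IwahoriHeckeSetup G W B M) : (1 : G) ∈ Gaff D :=
  (mem_Gaff D).2 ⟨1, D.Waff.one_mem, by simpa using IwI_self (I := D.I) (π := D.π) 1⟩

theorem Gaff_inv (D : IwahoriHeckeSetup G W B M) {g : G} (hg : g ∈ Gaff D) : g⁻¹ ∈ Gaff D := by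
  rw [mem_Gaff] at hg ⊢
  obtain ⟨w, hw, h⟩ := hg
  exact ⟨w⁻¹, D.Waff.inv_mem hw, IwI_inv h⟩

/-! ### Sums over cosets -/

theorem out_inv {I : Subgroup G} {F : G → ℤ} (hF : ∀ i ∈ I, ∀ g, F (g * i) = F g) (g : G) :
    F (Quotient.out (g : G ⧸ I)) = F g := by
  obtain ⟨h, hh⟩ := QuotientGroup.mk_out_eq_mul I g
  rw [hh, hF _ h.2]

theorem sum_equiv {I : Subgroup G} {F : G → ℤ} (hF : ∀ i ∈ I, ∀ g, F (g * i) = F g)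
    (e : G ≃ G) (he : ∀ a b, a⁻¹ * b ∈ I ↔ (e a)⁻¹ * e b ∈ I) :
    ∑ᶠ y : G ⧸ I, F (e (Quotient.out y)) = ∑ᶠ y : G ⧸ I, F (Quotient.out y) := by
  let E : G ⧸ I ≃ G ⧸ I := Quotient.congr e (fun a b => by
    rw [QuotientGroup.leftRel_apply, QuotientGroup.leftRel_apply]
    exact he a b)
  rw [← finsum_comp_equiv E (f := fun y : G ⧸ I => F (Quotient.out y))]
  congr 1
  ext y
  have h1 : E y = ((e (Quotient.out y) : G) : G ⧸ I) := by
    conv_lhs => rw [← Quotient.out_eq y]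
    rfl
  rw [h1, out_inv hF]

theorem iw_left {I N : Subgroup G} {π : N →* W} (w : W) :
    ∀ i ∈ I, ∀ g, iw I π w (i * g) = iw I π w g := by
  intro i hi g
  classical
  simp only [iw, Set.indicator_apply, IwI_left hi]

theorem iw_right {I N : Subgroup G} {π : N →* W} (w : W) :
    ∀ i ∈ I, ∀ g, iw I π w (g * i) = iw I π w g := by
  intro i hi g
  classical
  simp only [iw, Set.indicator_apply, IwI_right hi]

theorem iw_rep (D : IwahoriHeckeSetup G W B M) [DecidableEq W] (n : D.N) (w : W) :
    iw D.I D.π w n = if D.π n = w then 1 else 0 := by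
  classical
  simp only [iw, Set.indicator_apply]
  refine if_congr ⟨fun h => IwI_unique D (IwI_self n) h, fun h => h ▸ IwI_self n⟩ rfl rfl

theorem hconv_right {I : Subgroup G} {f f' : G → ℤ} (h' : ∀ i ∈ I, ∀ g, f' (g * i) = f' g) :
    ∀ i ∈ I, ∀ g, hconv I f f' (g * i) = hconv I f f' g := by
  intro i hi g
  simp only [hconv, ← mul_assoc, h' i hi]

theorem prod_right {I : Subgroup G} {f f' : G → ℤ} (h : ∀ i ∈ I, ∀ g, f (g * i) = f g)
    (h' : ∀ i ∈ I, ∀ g, f' (i * g) = f' g) (x : G) :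
    ∀ i ∈ I, ∀ g, f (g * i) * f' ((g * i)⁻¹ * x) = f g * f' (g⁻¹ * x) := by
  intro i hi g
  rw [h i hi, mul_inv_rev, mul_assoc, h' _ (I.inv_mem hi)]

theorem hconv_left {I : Subgroup G} {f f' : G → ℤ} (h : ∀ i ∈ I, ∀ g, f (g * i) = f g)
    (h' : ∀ i ∈ I, ∀ g, f' (i * g) = f' g) (h'' : ∀ i ∈ I, ∀ g, f (i * g) = f g) :
    ∀ i ∈ I, ∀ g, hconv I f f' (i * g) = hconv I f f' g := by
  intro i hi g
  have := sum_equiv (F := fun y => f y * f' (y⁻¹ * (i * g))) (prod_right h h' (i * g)) (Equiv.mulLeft i)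
    (fun a b => by simp [mul_assoc])
  simp only [hconv]
  rw [← this]
  congr 1
  ext y
  simp [h'' i hi, mul_assoc]

theorem hconv_Om (D : IwahoriHeckeSetup G W B M) {n : D.N} (hn : D.π n ∈ D.Om) {f : G → ℤ}
    (hf : ∀ i ∈ D.I, ∀ g, f (i * g) = f g) (x : G) :
    hconv D.I (iw D.I D.π (D.π n)) f x = f ((n : G)⁻¹ * x) := by
  classical
  have hP := prod_right (iw_right (I := D.I) (π := D.π) (D.π n)) hf x
  simp only [hconv]
  rw [finsum_eq_single _ ((n : G) : G ⧸ D.I)]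
  · have := out_inv (F := fun y => iw D.I D.π (D.π n) y * f (y⁻¹ * x)) hP (n : G)
    rw [this, iw_rep, if_pos rfl, one_mul]
  · intro y hy
    have : Quotient.out y ∉ IwI D.I D.π (D.π n) := by
      intro h
      apply hy
      have h1 : ((n : G) * ((n : G)⁻¹ * Quotient.out y)) ∈ IwI D.I D.π (D.π n * 1) := by simpa
      rw [Om_left D hn] at h1
      obtain ⟨m, hm, a, ha, b, hb, h2⟩ := h1
      have hmI := (D.π_ker m).1 hm
      have h3 : (n : G)⁻¹ * Quotient.out y ∈ D.I := by
        rw [h2]; exact D.I.mul_mem (D.I.mul_mem ha hmI) hb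
      rw [← QuotientGroup.eq] at h3
      rw [h3]; exact (Quotient.out_eq y).symm
    simp [iw, this]

theorem hconv_Om_iw (D : IwahoriHeckeSetup G W B M) {u : W} (hu : u ∈ D.Om) (w : W) :
    hconv D.I (iw D.I D.π u) (iw D.I D.π w) = iw D.I D.π (u * w) := by
  classical
  obtain ⟨n, rfl⟩ := D.π_surjective u
  ext x
  rw [hconv_Om D hu (iw_left w)]
  simp only [iw, Set.indicator_apply]
  refine if_congr ?_ rfl rfl
  rw [← Om_left D hu]
  simp

theorem twisted (D : IwahoriHeckeSetup G W B M) {u u' : W} (hu : u ∈ D.Om) (hu' : u' ∈ D.Om)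
    (w w' : W) :
    hconv D.I (hconv D.I (iw D.I D.π u) (iw D.I D.π w))
            (hconv D.I (iw D.I D.π u') (iw D.I D.π w')) =
          hconv D.I (iw D.I D.π (u * u'))
            (hconv D.I (iw D.I D.π (u'⁻¹ * w * u')) (iw D.I D.π w')) := by
  classical
  rw [hconv_Om_iw D hu, hconv_Om_iw D hu']
  obtain ⟨n, rfl⟩ := D.π_surjective u
  obtain ⟨m, rfl⟩ := D.π_surjective u'
  ext x
  have hnm : D.π (n * m) ∈ D.Om := by rw [map_mul]; exact D.Om.mul_mem hu hu'
  rw [← map_mul, hconv_Om D hnm (hconv_left (iw_right _) (iw_left _) (iw_left _))]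
  simp only [hconv]
  have := sum_equiv
    (F := fun y => iw D.I D.π (D.π n * w) y * iw D.I D.π (D.π m * w') (y⁻¹ * x))
    (prod_right (iw_right (I := D.I) (π := D.π) (D.π n * w))
    (iw_left (I := D.I) (π := D.π) (D.π m * w')) x)
    ((Equiv.mulLeft ((n : G) * m)).trans (Equiv.mulRight (m : G)⁻¹)) (fun a b => by
      rw [← TOm_iff D hu' (a⁻¹ * b)]
      simp [mul_assoc])
  rw [← this]
  congr 1
  ext y
  generalize Quotient.out y = z
  simp only [Equiv.trans_apply, Equiv.coe_mulLeft, Equiv.coe_mulRight]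
  congr 1
  · simp only [iw, Set.indicator_apply]
    refine if_congr ?_ rfl rfl
    rw [← Om_conj D hu', ← Om_left D hu (w := w)]
    simp [mul_assoc]
  · simp only [iw, Set.indicator_apply]
    refine if_congr ?_ rfl rfl
    rw [← Om_left D hu' (w := w')]
    simp [mul_assoc]

/-! ### Finiteness -/

theorem fin_cosets (D : IwahoriHeckeSetup G W B M) {f : G → ℤ} (hf : IsHeckeElt D.I D.π f) :
    {y : G ⧸ D.I | ∃ g : G, (g : G ⧸ D.I) = y ∧ f g ≠ 0}.Finite := by
  refine (hf.2.2.biUnion (t := fun w => leftCosetsIn D.I (IwI D.I D.π w))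
    fun w _ => (D.TF w).1).subset ?_
  rintro y ⟨g, rfl, hg⟩
  obtain ⟨w, hw⟩ := D.T0_cover g
  simp only [Set.mem_iUnion]
  exact ⟨w, ⟨g, hw, hg⟩, g, hw, rfl⟩

theorem fin_of_cosets (D : IwahoriHeckeSetup G W B M) {f : G → ℤ}
    (h : {y : G ⧸ D.I | ∃ g : G, (g : G ⧸ D.I) = y ∧ f g ≠ 0}.Finite) :
    {w : W | ∃ g ∈ IwI D.I D.π w, f g ≠ 0}.Finite := by
  choose wt hwt using D.T0_cover
  refine (h.image (fun y => wt (Quotient.out y))).subset ?_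
  rintro w ⟨g, hg, hfg⟩
  refine ⟨(g : G ⧸ D.I), ⟨g, rfl, hfg⟩, ?_⟩
  obtain ⟨i, hi⟩ := QuotientGroup.mk_out_eq_mul D.I g
  refine IwI_unique D (hwt _) ?_
  rw [hi]
  exact (IwI_right i.2).2 hg

theorem hconv_ne {I : Subgroup G} {f f' : G → ℤ} {x : G} (h : hconv I f f' x ≠ 0) :
    ∃ y : G ⧸ I, f (Quotient.out y) ≠ 0 ∧ f' ((Quotient.out y)⁻¹ * x) ≠ 0 := by
  by_contra hc
  push Not at hc
  apply h
  simp only [hconv]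
  rw [← finsum_zero (α := G ⧸ I)]
  congr 1
  ext y
  by_cases h0 : f (Quotient.out y) = 0
  · simp [h0]
  · simp [hc y h0]

theorem hconv_hecke (D : IwahoriHeckeSetup G W B M) {f f' : G → ℤ} (hf : IsHeckeElt D.I D.π f)
    (hf' : IsHeckeElt D.I D.π f') : IsHeckeElt D.I D.π (hconv D.I f f') := by
  refine ⟨hconv_left hf.2.1 hf'.1 hf.1, hconv_right hf'.2.1, fin_of_cosets D ?_⟩
  refine ((fin_cosets D hf).biUnion (t := fun y => (fun z => (Quotient.out y : G) • z) ''
    {y : G ⧸ D.I | ∃ g : G, (g : G ⧸ D.I) = y ∧ f' g ≠ 0})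
    fun y _ => (fin_cosets D hf').image _).subset ?_
  rintro _ ⟨x, rfl, hx⟩
  obtain ⟨y, h1, h2⟩ := hconv_ne hx
  simp only [Set.mem_iUnion]
  refine ⟨y, ⟨Quotient.out y, Quotient.out_eq y, h1⟩, _, ⟨_, rfl, h2⟩, ?_⟩
  change ((Quotient.out y * ((Quotient.out y)⁻¹ * x) : G) : G ⧸ D.I) = _
  simp

theorem iw_hecke (D : IwahoriHeckeSetup G W B M) (w : W) : IsHeckeElt D.I D.π (iw D.I D.π w) := by
  refine ⟨iw_left w, iw_right w, (Set.finite_singleton w).subset ?_⟩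
  rintro v ⟨g, hg, h⟩
  exact IwI_unique D hg (Set.mem_of_indicator_ne_zero h)

theorem expand_eval (D : IwahoriHeckeSetup G W B M) (c : W →₀ ℤ) (n : D.N) :
    (c.sum fun w z => z • iw D.I D.π w) n = c (D.π n) := by
  classical
  rw [Finsupp.sum, Finset.sum_apply]
  simp +contextual [iw_rep, eq_comm]

theorem hecke_ext (D : IwahoriHeckeSetup G W B M) {f f' : G → ℤ}
    (h1 : ∀ i ∈ D.I, ∀ g, f (i * g) = f g) (h2 : ∀ i ∈ D.I, ∀ g, f (g * i) = f g)
    (h1' : ∀ i ∈ D.I, ∀ g, f' (i * g) = f' g) (h2' : ∀ i ∈ D.I, ∀ g, f' (g * i) = f' g)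
    (h : ∀ n : D.N, f n = f' n) : f = f' := by
  ext g
  obtain ⟨w, n, hn, i, hi, j, hj, rfl⟩ := D.T0_cover g
  rw [h2 j hj, h1 i hi, h2' j hj, h1' i hi, h]

theorem expand_exists (D : IwahoriHeckeSetup G W B M) {f : G → ℤ} (hf : IsHeckeElt D.I D.π f) :
    ∃ c : W →₀ ℤ, (∀ n : D.N, c (D.π n) = f n) ∧ f = c.sum fun w z => z • iw D.I D.π w := by
  classical
  choose r hr using D.π_surjective
  let c : W →₀ ℤ := Finsupp.ofSupportFinite (fun w => f (r w)) (hf.2.2.subset (by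
    intro w hw
    exact ⟨r w, by simpa [hr w] using IwI_self (I := D.I) (π := D.π) (r w), hw⟩))
  have hc : ∀ n : D.N, c (D.π n) = f n := by
    intro n
    change f (r (D.π n)) = f n
    have h : ((n⁻¹ * r (D.π n) : D.N) : G) ∈ D.I := (D.π_ker _).1 (by simp [hr])
    rw [← hf.2.1 _ h n]
    simp
  refine ⟨c, hc, hecke_ext D hf.1 hf.2.1 ?_ ?_ fun n => by rw [expand_eval, hc]⟩
  · intro i hi g
    simp only [Finsupp.sum, Finset.sum_apply, Pi.smul_apply, iw_left _ i hi]
  · intro i hi g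
    simp only [Finsupp.sum, Finset.sum_apply, Pi.smul_apply, iw_right _ i hi]

theorem double_eval (D : IwahoriHeckeSetup G W B M) (c : W →₀ (W →₀ ℤ))
    (h1 : (c.support : Set W) ⊆ (D.Om : Set W))
    (h2 : ∀ u : W, ((c u).support : Set W) ⊆ (D.Waff : Set W))
    {u w : W} (hu : u ∈ D.Om) (hw : w ∈ D.Waff) (n : D.N) (hn : D.π n = u * w) :
    (c.sum fun u d => d.sum fun w z =>
          z • hconv D.I (iw D.I D.π u) (iw D.I D.π w)) n = c u w := by
  classical
  have key : ∀ v ∈ D.Om, ∀ x ∈ D.Waff, u * w = v * x → u = v ∧ w = x := by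
    intro v hv x hx h
    have h3 : v⁻¹ * u = x * w⁻¹ := by
      rw [eq_mul_inv_iff_mul_eq, mul_assoc, h]; group
    have h4 : v⁻¹ * u ∈ D.Waff ⊓ D.Om :=
      ⟨by rw [h3]; exact D.Waff.mul_mem hx (D.Waff.inv_mem hw),
        D.Om.mul_mem (D.Om.inv_mem hv) hu⟩
    rw [D.sd_disj, Subgroup.mem_bot] at h4
    have h5 : u = v := (inv_mul_eq_one.1 h4).symm
    subst h5
    exact ⟨rfl, mul_left_cancel h⟩
  rw [Finsupp.sum, Finset.sum_apply, Finset.sum_eq_single u]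
  · rw [Finsupp.sum, Finset.sum_apply, Finset.sum_eq_single w]
    · simp [hconv_Om_iw D hu, iw_rep, hn]
    · intro x hx hne
      have : ¬ (u * w = u * x) := fun h => hne (mul_left_cancel h).symm
      simp [hconv_Om_iw D hu, iw_rep, hn, hne.symm]
    · intro h
      simp [Finsupp.notMem_support_iff.1 h]
  · intro v hv hne
    rw [Finsupp.sum, Finset.sum_apply]
    refine Finset.sum_eq_zero fun x hx => ?_
    have : ¬ (u * w = v * x) := fun h => hne (key v (h1 hv) x (h2 v hx) h).1.symm
    simp [hconv_Om_iw D (h1 hv), iw_rep, hn, this]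
  · intro h
    simp [Finsupp.notMem_support_iff.1 h]

theorem sd_prod' (D : IwahoriHeckeSetup G W B M) (v : W) :
    ∃ u ∈ D.Om, ∃ w ∈ D.Waff, v = u * w := by
  obtain ⟨a, ha, u, hu, h⟩ := D.sd_prod v⁻¹
  refine ⟨u⁻¹, D.Om.inv_mem hu, a⁻¹, D.Waff.inv_mem ha, ?_⟩
  rw [← mul_inv_rev, ← h, inv_inv]

theorem double_exists (D : IwahoriHeckeSetup G W B M) (d : W →₀ ℤ) :
    ∃ c : W →₀ (W →₀ ℤ), (c.support : Set W) ⊆ (D.Om : Set W) ∧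
        (∀ u : W, ((c u).support : Set W) ⊆ (D.Waff : Set W)) ∧
        (d.sum fun w z => z • iw D.I D.π w) = c.sum fun u d => d.sum fun w z =>
          z • hconv D.I (iw D.I D.π u) (iw D.I D.π w) := by
  classical
  induction d using Finsupp.induction_linear with
  | zero => exact ⟨0, by simp, by simp, by simp⟩
  | add f g hf hg =>
    obtain ⟨c, h1, h2, h3⟩ := hf
    obtain ⟨c', h1', h2', h3'⟩ := hg
    refine ⟨c + c', ?_, ?_, ?_⟩
    · intro x hx
      rcases Finset.mem_union.1 (Finsupp.support_add hx) with h | h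
      · exact h1 h
      · exact h1' h
    · intro u x hx
      rcases Finset.mem_union.1 (Finsupp.support_add hx) with h | h
      · exact h2 u h
      · exact h2' u h
    · rw [Finsupp.sum_add_index' (by simp) (by intros; rw [add_smul]), h3, h3',
        Finsupp.sum_add_index' (by simp)]
      intro a b b'
      rw [Finsupp.sum_add_index' (by simp) (by intros; rw [add_smul])]
  | single v z =>
    obtain ⟨u, hu, w, hw, rfl⟩ := sd_prod' D v
    refine ⟨Finsupp.single u (Finsupp.single w z), ?_, ?_, ?_⟩
    · intro x hx
      have := Finsupp.support_single_subset hx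
      rw [Finset.mem_singleton] at this
      rw [this]; exact hu
    · intro u' x hx
      have hx' : x ∈ (Finsupp.single u (Finsupp.single w z) u').support := hx
      rw [Finsupp.single_apply] at hx'
      split_ifs at hx'
      · have := Finsupp.support_single_subset hx'
        rw [Finset.mem_singleton] at this
        rw [this]; exact hw
      · simp at hx'
    · rw [Finsupp.sum_single_index (by simp), Finsupp.sum_single_index (by simp),
        Finsupp.sum_single_index (by simp), hconv_Om_iw D hu]

end Helpers

/-- (1) `G_aff = ⋃_{w ∈ W_aff} IwI` is a subgroup of `G`; (2) the set `H^aff` of elements of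
`H(G,I)` vanishing outside `G_aff` is a subring of `H(G,I)` with `ℤ`-basis
`{i_w : w ∈ W_aff}`; (3) the `ℤ`-linear map `ℤ[Ω] ⊗_ℤ H^aff → H(G,I)`, `u ⊗ f ↦ i_u ⋆ f`,
is bijective (equivalently: every element of `H(G,I)` has a unique expansion
`Σ_{u ∈ Ω, w ∈ W_aff} c_{u,w} · (i_u ⋆ i_w)`), and it transports the multiplication of
`H(G,I)` to the twisted product determined by
`(u ⊗ i_w)·(u' ⊗ i_{w'}) = uu' ⊗ (i_{u'⁻¹wu'} ⋆ i_{w'})` for `u, u' ∈ Ω`,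
`w, w' ∈ W_aff`. -/
theorem haff_and_twisted_tensor_decomposition {G W B : Type} [Group G] [Group W]
    {M : CoxeterMatrix B} (D : IwahoriHeckeSetup G W B M) :
    -- `G_aff` is a subgroup of `G`
    (∃ Ga : Subgroup G, (Ga : Set G) = Gaff D) ∧
    -- `H^aff` is a subring: it contains the unit `i_1` and is closed under
    -- addition, negation and convolution
    InHaff D (iw D.I D.π 1) ∧
    (∀ f f' : G → ℤ, InHaff D f → InHaff D f' → InHaff D (f + f')) ∧
    (∀ f : G → ℤ, InHaff D f → InHaff D (-f)) ∧
    (∀ f f' : G → ℤ, InHaff D f → InHaff D f' → InHaff D (hconv D.I f f')) ∧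
    -- `{i_w : w ∈ W_aff}` is a `ℤ`-basis of `H^aff`
    (∀ f : G → ℤ, InHaff D f → ∃! c : W →₀ ℤ,
        (c.support : Set W) ⊆ (D.Waff : Set W) ∧
        f = c.sum fun w z => z • iw D.I D.π w) ∧
    -- bijectivity of `ℤ[Ω] ⊗_ℤ H^aff → H(G,I)`, `u ⊗ f ↦ i_u ⋆ f`:
    -- unique expansion in the elements `i_u ⋆ i_w`, `u ∈ Ω`, `w ∈ W_aff`
    (∀ f : G → ℤ, IsHeckeElt D.I D.π f → ∃! c : W →₀ (W →₀ ℤ),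
        (c.support : Set W) ⊆ (D.Om : Set W) ∧
        (∀ u : W, ((c u).support : Set W) ⊆ (D.Waff : Set W)) ∧
        f = c.sum fun u d => d.sum fun w z =>
          z • hconv D.I (iw D.I D.π u) (iw D.I D.π w)) ∧
    -- the multiplication is the twisted product
    (∀ u ∈ D.Om, ∀ u' ∈ D.Om, ∀ w ∈ D.Waff, ∀ w' ∈ D.Waff,
        hconv D.I (hconv D.I (iw D.I D.π u) (iw D.I D.π w))
            (hconv D.I (iw D.I D.π u') (iw D.I D.π w')) =
          hconv D.I (iw D.I D.π (u * u'))
            (hconv D.I (iw D.I D.π (u'⁻¹ * w * u')) (iw D.I D.π w'))) := by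
  classical
  refine ⟨⟨{ carrier := Gaff D, mul_mem' := Gaff_mul D, one_mem' := Gaff_one D,
             inv_mem' := Gaff_inv D }, rfl⟩, ?_, ?_, ?_, ?_, ?_, ?_, ?_⟩
  · refine ⟨iw_hecke D 1, fun g hg => ?_⟩
    refine Set.indicator_of_notMem (fun h => hg ?_) _
    exact (mem_Gaff D).2 ⟨1, D.Waff.one_mem, h⟩
  · rintro f f' ⟨⟨h1, h2, h3⟩, h4⟩ ⟨⟨h1', h2', h3'⟩, h4'⟩
    refine ⟨⟨fun i hi g => ?_, fun i hi g => ?_, (h3.union h3').subset ?_⟩, fun g hg => ?_⟩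
    · simp [h1 i hi, h1' i hi]
    · simp [h2 i hi, h2' i hi]
    · rintro w ⟨g, hg, h⟩
      by_cases h0 : f g = 0
      · right
        exact ⟨g, hg, fun h5 => h (by simp [h0, h5])⟩
      · left
        exact ⟨g, hg, h0⟩
    · simp [h4 g hg, h4' g hg]
  · rintro f ⟨⟨h1, h2, h3⟩, h4⟩
    refine ⟨⟨fun i hi g => ?_, fun i hi g => ?_, ?_⟩, fun g hg => ?_⟩
    · simp [h1 i hi]
    · simp [h2 i hi]
    · simpa using h3
    · simp [h4 g hg]
  · rintro f f' ⟨hf, h4⟩ ⟨hf', h4'⟩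
    refine ⟨hconv_hecke D hf hf', fun g hg => ?_⟩
    by_contra h
    obtain ⟨y, hy1, hy2⟩ := hconv_ne h
    have a1 : Quotient.out y ∈ Gaff D := by
      by_contra h0; exact hy1 (h4 _ h0)
    have a2 : (Quotient.out y)⁻¹ * g ∈ Gaff D := by
      by_contra h0; exact hy2 (h4' _ h0)
    apply hg
    simpa using Gaff_mul D a1 a2
  · rintro f ⟨hf, h4⟩
    obtain ⟨c, hc, hfc⟩ := expand_exists D hf
    refine ⟨c, ⟨?_, hfc⟩, ?_⟩
    · intro w hw
      obtain ⟨n, rfl⟩ := D.π_surjective w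
      by_contra hne
      have h5 : c (D.π n) ≠ 0 := by simpa using hw
      rw [hc] at h5
      apply h5
      apply h4
      intro h
      obtain ⟨v, hv, h⟩ := (mem_Gaff D).1 h
      apply hne
      rw [IwI_unique D (IwI_self n) h]
      exact hv
    · rintro c' ⟨-, h⟩
      ext w
      obtain ⟨n, rfl⟩ := D.π_surjective w
      rw [hc, ← expand_eval D c' n, ← h]
  · intro f hf
    obtain ⟨d, hd, hfd⟩ := expand_exists D hf
    obtain ⟨c, h1, h2, h3⟩ := double_exists D d
    refine ⟨c, ⟨h1, h2, hfd.trans h3⟩, ?_⟩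
    rintro c' ⟨h1', h2', h3'⟩
    ext u w
    by_cases hu : u ∈ D.Om
    · by_cases hw : w ∈ D.Waff
      · obtain ⟨n, hn⟩ := D.π_surjective (u * w)
        rw [← double_eval D c h1 h2 hu hw n hn, ← double_eval D c' h1' h2' hu hw n hn, ← h3',
          ← h3, ← hfd]
      · rw [Finsupp.notMem_support_iff.1 fun h => hw (h2 u h),
          Finsupp.notMem_support_iff.1 fun h => hw (h2' u h)]
    · rw [Finsupp.notMem_support_iff.1 fun h => hu (h1 h),
          Finsupp.notMem_support_iff.1 fun h => hu (h1' h)]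
  · intro u hu u' hu' w _ w' _
    exact twisted D hu hu' w w'
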